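/- arXiv:2208.00898 — 2 statements merged into one kernel-verified Lean document; each statement's English description precedes it below -/
import Mathlib

section
/- Let Z be a measurable space equipped with a σ-finite measure μ, let Y be a set, and let d : Y × Y → ℝ be a loss function that is non-negative, symmetric (d(a,b) = d(b,a) for all a, b), and satisfies the triangle inequality (d(a,c) ≤ d(a,b) + d(b,c) for all a, b, c). Let p⁽ˢ⁾, p⁽ᵘ⁾ : Z → ℝ be non-negative measurable density functions (of the seen and unseen domain latent distributions), let g : Z → Y be a classifier, and let l⁽ˢ⁾, l⁽ᵘ⁾ : Z → Y be labeling functions. Assume the functions z ↦ p⁽ᵘ⁾(z)·d(g(z), l⁽ᵘ⁾(z)), z ↦ p⁽ˢ⁾(z)·d(g(z), l⁽ˢ⁾(z)), z ↦ p⁽ˢ⁾(z)·d(g(z), l⁽ᵘ⁾(z)), z ↦ |p⁽ᵘ⁾(z) − p⁽ˢ⁾(z)|·d(g(z), l⁽ᵘ⁾(z)), and z ↦ p⁽ˢ⁾(z)·d(l⁽ᵘ⁾(z), l⁽ˢ⁾(z)) are all integrable with respect to μ. Then the unseen-domain risk satisfies the bound: ∫ p⁽ᵘ⁾(z)·d(g(z),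 l⁽ᵘ⁾(z)) dμ(z) ≤ ∫ p⁽ˢ⁾(z)·d(g(z), l⁽ˢ⁾(z)) dμ(z) + ∫ |p⁽ᵘ⁾(z) − p⁽ˢ⁾(z)|·d(g(z), l⁽ᵘ⁾(z)) dμ(z) + ∫ p⁽ˢ⁾(z)·d(l⁽ᵘ⁾(z), l⁽ˢ⁾(z)) dμ(z). -/
/-- **Theorem 1** (upper bound on the unseen-domain risk).
For a non-negative, symmetric loss `d` satisfying the triangle inequality,
the unseen-domain risk is bounded by the seen-domain risk plus a
covariate-alignment term and a concept-alignment term. -/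
theorem unseen_risk_upper_bound
    {Z : Type*} [MeasurableSpace Z] (μ : MeasureTheory.Measure Z)
    [MeasureTheory.SigmaFinite μ]
    {Y : Type*} (d : Y → Y → ℝ)
    (hd_nonneg : ∀ a b, 0 ≤ d a b)
    (hd_symm : ∀ a b, d a b = d b a)
    (hd_tri : ∀ a b c, d a c ≤ d a b + d b c)
    (ps pu : Z → ℝ)
    (hps_nonneg : ∀ z, 0 ≤ ps z) (hpu_nonneg : ∀ z, 0 ≤ pu z)
    (hps_meas : Measurable ps) (hpu_meas : Measurable pu)
    (g ls lu : Z → Y)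
    (h1 : MeasureTheory.Integrable (fun z => pu z * d (g z) (lu z)) μ)
    (h2 : MeasureTheory.Integrable (fun z => ps z * d (g z) (ls z)) μ)
    (h3 : MeasureTheory.Integrable (fun z => ps z * d (g z) (lu z)) μ)
    (h4 : MeasureTheory.Integrable (fun z => |pu z - ps z| * d (g z) (lu z)) μ)
    (h5 : MeasureTheory.Integrable (fun z => ps z * d (lu z) (ls z)) μ) :
    ∫ z, pu z * d (g z) (lu z) ∂μ ≤
      (∫ z, ps z * d (g z) (ls z) ∂μ)
      + (∫ z, |pu z - ps z| * d (g z) (lu z) ∂μ)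
      + (∫ z, ps z * d (lu z) (ls z) ∂μ) := by
  have h24 : MeasureTheory.Integrable
      (fun z => ps z * d (g z) (ls z) + |pu z - ps z| * d (g z) (lu z)) μ := h2.add h4
  rw [← MeasureTheory.integral_add h2 h4, ← MeasureTheory.integral_add h24 h5]
  refine MeasureTheory.integral_mono h1 (h24.add h5) ?_
  intro z
  have t := hd_tri (g z) (ls z) (lu z)
  rw [hd_symm (ls z) (lu z)] at t
  have a := mul_le_mul_of_nonneg_left t (hps_nonneg z)
  have b := mul_le_mul_of_nonneg_right (le_abs_self (pu z - ps z)) (hd_nonneg (g z) (lu z))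
  change pu z * d (g z) (lu z) ≤
    ps z * d (g z) (ls z) + |pu z - ps z| * d (g z) (lu z) + ps z * d (lu z) (ls z)
  linarith
end

section
/- Let Z be a measurable space equipped with a σ-finite measure μ, let Y be a set, and let d : Y × Y → ℝ be a loss function that is non-negative, symmetric (d(a,b) = d(b,a) for all a, b), and satisfies the triangle inequality (d(a,c) ≤ d(a,b) + d(b,c) for all a, b, c). Let p⁽ˢ⁾, p⁽ᵘ⁾ : Z → ℝ be non-negative measurable density functions with ∫ p⁽ˢ⁾(z) dμ(z) = 1, let g : Z → Y be a classifier, and let l⁽ˢ⁾, l⁽ᵘ⁾ : Z → Y be labeling functions. Let Δ₁ ≥ 0 be an upper bound on the pointwise mismatch of marginals, i.e., |p⁽ˢ⁾(z) − p⁽ᵘ⁾(z)| ≤ Δ₁ for all z ∈ Z, and let Δ₂ ≥ 0 be an upper bound on the mismatch of optimal labeling functions, i.e., d(l⁽ᵘ⁾(z), l⁽ˢ⁾(z)) ≤ Δ₂ for all z ∈ Z. Assume the functions z ↦ p⁽ᵘ⁾(z)·d(g(z), l⁽ᵘ⁾(z)), z ↦ p⁽ˢ⁾(z)·d(g(z),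 l⁽ˢ⁾(z)), z ↦ p⁽ˢ⁾(z)·d(g(z), l⁽ᵘ⁾(z)), and z ↦ d(g(z), l⁽ᵘ⁾(z)) are integrable with respect to μ. Then: ∫ p⁽ᵘ⁾(z)·d(g(z), l⁽ᵘ⁾(z)) dμ(z) ≤ ∫ p⁽ˢ⁾(z)·d(g(z), l⁽ˢ⁾(z)) dμ(z) + Δ₁ · ∫ d(g(z), l⁽ᵘ⁾(z)) dμ(z) + Δ₂. -/
/-- **Corollary 1**.
With `Δ₁` a pointwise bound on the mismatch of marginal densities (covariate-shift)
and `Δ₂` a pointwise bound on the mismatch of optimal labeling functions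
(concept-shift), the unseen-domain risk is bounded by the seen-domain risk
plus `Δ₁ · ∫ d(g z, lu z) dμ + Δ₂`. -/
theorem unseen_risk_upper_bound_corollary
    {Z : Type*} [MeasurableSpace Z] (μ : MeasureTheory.Measure Z)
    [MeasureTheory.SigmaFinite μ]
    {Y : Type*} (d : Y → Y → ℝ)
    (hd_nonneg : ∀ a b, 0 ≤ d a b)
    (hd_symm : ∀ a b, d a b = d b a)
    (hd_tri : ∀ a b c, d a c ≤ d a b + d b c)
    (ps pu : Z → ℝ)
    (hps_nonneg : ∀ z, 0 ≤ ps z) (hpu_nonneg : ∀ z, 0 ≤ pu z)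
    (hps_meas : Measurable ps) (hpu_meas : Measurable pu)
    (hps_prob : ∫ z, ps z ∂μ = 1)
    (g ls lu : Z → Y)
    (Δ₁ Δ₂ : ℝ) (hΔ₁_nonneg : 0 ≤ Δ₁) (hΔ₂_nonneg : 0 ≤ Δ₂)
    (hΔ₁ : ∀ z, |ps z - pu z| ≤ Δ₁)
    (hΔ₂ : ∀ z, d (lu z) (ls z) ≤ Δ₂)
    (h1 : MeasureTheory.Integrable (fun z => pu z * d (g z) (lu z)) μ)
    (h2 : MeasureTheory.Integrable (fun z => ps z * d (g z) (ls z)) μ)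
    (h3 : MeasureTheory.Integrable (fun z => ps z * d (g z) (lu z)) μ)
    (h4 : MeasureTheory.Integrable (fun z => d (g z) (lu z)) μ) :
    ∫ z, pu z * d (g z) (lu z) ∂μ ≤
      (∫ z, ps z * d (g z) (ls z) ∂μ)
      + Δ₁ * (∫ z, d (g z) (lu z) ∂μ)
      + Δ₂ := by
  have hps : MeasureTheory.Integrable ps μ := by
    by_contra h
    rw [MeasureTheory.integral_undef h] at hps_prob
    exact zero_ne_one hps_prob
  have h5 := h4.const_mul Δ₁
  have h6 := hps.const_mul Δ₂
  have h7 : MeasureTheory.Integrable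
      (fun z => ps z * d (g z) (ls z) + Δ₁ * d (g z) (lu z)) μ := h2.add h5
  have key : ∫ z, pu z * d (g z) (lu z) ∂μ ≤
      ∫ z, (ps z * d (g z) (ls z) + Δ₁ * d (g z) (lu z)) + Δ₂ * ps z ∂μ := by
    refine MeasureTheory.integral_mono h1 (h7.add h6) ?_
    intro z
    have a1 : pu z - ps z ≤ Δ₁ := by
      have := (abs_le.mp (hΔ₁ z)).1
      linarith
    have a2 : d (g z) (lu z) ≤ d (g z) (ls z) + Δ₂ := by
      have t1 := hd_tri (g z) (ls z) (lu z)
      have t2 := hΔ₂ z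
      rw [hd_symm] at t2
      linarith
    have b1 := mul_le_mul_of_nonneg_right a1 (hd_nonneg (g z) (lu z))
    have b2 := mul_le_mul_of_nonneg_left a2 (hps_nonneg z)
    show pu z * d (g z) (lu z) ≤
      (ps z * d (g z) (ls z) + Δ₁ * d (g z) (lu z)) + Δ₂ * ps z
    linarith
  rw [MeasureTheory.integral_add h7 h6, MeasureTheory.integral_add h2 h5,
    MeasureTheory.integral_const_mul, MeasureTheory.integral_const_mul, hps_prob, mul_one] at key
  exact key
end
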